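/- Let z ∈ ℂ with Im(z) > 0, let h ∈ ℝ with h ≥ 0, and let b ∈ ℝ. Suppose w₁ ∈ ℂ satisfies Im(w₁) > 0 and w₁² = z² − 2h, and w₂ ∈ ℂ satisfies Im(w₂) > 0 and w₂² = (w₁ + b)² − 2h. Then Im(w₂) ≥ Im(w₁) ≥ Im(z). In particular, one full step w₂ of the Ninomiya-Victoir scheme applied to the backward Loewner equation does not decrease the imaginary part: if Im(z) ≥ y for some y > 0 then Im(w₂) ≥ y. -/

import Mathlib

open Complex

/-- If `w` is the upper half-plane square root of `z ^ 2 - c` with `c` real and nonnegative, then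
the imaginary part of `w` is at least that of `z`. -/
theorem im_le_im_of_sq_eq_sq_sub {z w : ℂ} {c : ℝ} (hc : 0 ≤ c) (hw : 0 < w.im)
    (hsq : w ^ 2 = z ^ 2 - (c : ℂ)) : z.im ≤ w.im := by
  have hre : w.re * w.re - w.im * w.im = z.re * z.re - z.im * z.im - c := by
    simpa [sq] using congrArg Complex.re hsq
  have him : w.re * w.im = z.re * z.im := by
    have := congrArg Complex.im hsq
    simp only [sq, Complex.mul_im, Complex.sub_im, Complex.ofReal_im] at this
    linarith
  by_contra! hlt
  have him_sq : w.im ^ 2 < z.im ^ 2 := by gcongr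
  have hprod : z.re ^ 2 * z.im ^ 2 = w.re ^ 2 * w.im ^ 2 := by
    rw [← mul_pow, ← mul_pow, him]
  have hre_sq : z.re ^ 2 ≤ w.re ^ 2 := by
    refine le_of_mul_le_mul_right ?_ (pow_pos hw 2)
    rw [← hprod]
    gcongr
  nlinarith

/-- One full step of the Ninomiya-Victoir scheme for the backward Loewner
equation does not decrease the imaginary part: with `w₁` and `w₂` the upper
half-plane square roots of `z² - 2h` and `(w₁ + b)² - 2h` respectively, one has
`Im w₂ ≥ Im w₁ ≥ Im z`; in particular `Im z ≥ y > 0` implies `Im w₂ ≥ y`. -/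
theorem stmt11 (z : ℂ) (hz : 0 < z.im) (h : ℝ) (hh : 0 ≤ h) (b : ℝ)
    (w₁ w₂ : ℂ) (hw₁ : 0 < w₁.im) (hw₁sq : w₁ ^ 2 = z ^ 2 - 2 * (h : ℂ))
    (hw₂ : 0 < w₂.im) (hw₂sq : w₂ ^ 2 = (w₁ + (b : ℂ)) ^ 2 - 2 * (h : ℂ)) :
    w₁.im ≤ w₂.im ∧ z.im ≤ w₁.im ∧
      ∀ y : ℝ, 0 < y → y ≤ z.im → y ≤ w₂.im := by
  have hc : 0 ≤ 2 * h := by positivity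
  have h₁ : z.im ≤ w₁.im :=
    im_le_im_of_sq_eq_sq_sub hc hw₁ (by push_cast; exact hw₁sq)
  have h₂ : w₁.im ≤ w₂.im := by
    simpa using im_le_im_of_sq_eq_sq_sub hc hw₂
      (show w₂ ^ 2 = (w₁ + (b : ℂ)) ^ 2 - ((2 * h : ℝ) : ℂ) by push_cast; exact hw₂sq)
  exact ⟨h₂, h₁, fun y _ hy => hy.trans (h₁.trans h₂)⟩
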